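/- arXiv:2301.12949 — 2 statements merged into one kernel-verified Lean document; each statement's English description precedes it below -/
import Mathlib

section
/- Let V be a real vector space and p a Hilbertian seminorm on V admitting a countable complete p-orthonormal system {eₙ : n ∈ ℕ}. Choose (λₙ)_{n∈ℕ} ⊆ (0,∞) with ∑_{n=1}^∞ λₙ² < ∞, and set U := {v ∈ V : ∑_{n=1}^∞ λₙ⁻² ⟨v, eₙ⟩ₚ² < ∞}. Then: (i) U is a linear subspace of V that is dense in V with respect to p; (ii) q(v) := √(∑_{n=1}^∞ λₙ⁻² ⟨v, eₙ⟩ₚ²) defines a Hilbertian seminorm on U; and (iii) tr(p|_U / q) = ∑_{n=1}^∞ λₙ² < ∞. -/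
open MeasureTheory
open scoped ENNReal

noncomputable section

/-- The character space `X(A)` of a unital commutative `ℝ`-algebra `A`:
the set of `ℝ`-algebra homomorphisms `A → ℝ`. -/
abbrev Character (A : Type*) [CommRing A] [Algebra ℝ A] := A →ₐ[ℝ] ℝ

/-- The weak topology on the character space: the weakest topology making all
evaluations `α ↦ α a` continuous. -/
instance Character.instTopologicalSpace (A : Type*) [CommRing A] [Algebra ℝ A] :
    TopologicalSpace (Character A) :=
  TopologicalSpace.induced (fun (α : Character A) (a : A) => α a) inferInstance

/-- The Borel σ-algebra on the character space. -/
instance Character.instMeasurableSpace (A : Type*) [CommRing A] [Algebra ℝ A] :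
    MeasurableSpace (Character A) :=
  borel (Character A)

/-- A Radon measure: a locally finite Borel measure that is inner regular with
respect to compact sets. -/
def IsRadonMeasure {X : Type*} [TopologicalSpace X] [MeasurableSpace X]
    (μ : Measure X) : Prop :=
  IsLocallyFiniteMeasure μ ∧ μ.InnerRegularWRT IsCompact MeasurableSet

/-- A Hilbertian seminorm on a real vector space `V`: a seminorm induced by a
symmetric positive semidefinite bilinear form, recorded by the form itself. -/
structure HilbSeminorm (V : Type*) [AddCommGroup V] [Module ℝ V] where
  bilin : V →ₗ[ℝ] V →ₗ[ℝ] ℝ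
  symm : ∀ v w, bilin v w = bilin w v
  nonneg : ∀ v, 0 ≤ bilin v v

namespace HilbSeminorm

variable {V W : Type*} [AddCommGroup V] [Module ℝ V] [AddCommGroup W] [Module ℝ W]

/-- The seminorm associated to a Hilbertian seminorm: `p v = √⟨v,v⟩ₚ`. -/
def toFun (p : HilbSeminorm V) (v : V) : ℝ := Real.sqrt (p.bilin v v)

/-- Pullback of a Hilbertian seminorm along a linear map (e.g. restriction to a
subspace along the inclusion). -/
def comp (p : HilbSeminorm V) (f : W →ₗ[ℝ] V) : HilbSeminorm W where
  bilin := LinearMap.compl₁₂ p.bilin f f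
  symm v w := by
    simp only [LinearMap.compl₁₂_apply]
    exact p.symm (f v) (f w)
  nonneg v := by
    simp only [LinearMap.compl₁₂_apply]
    exact p.nonneg (f v)

/-- The Hilbertian seminorm `c • p`, induced by the bilinear form `c² ⟨·,·⟩ₚ`. -/
def smul (p : HilbSeminorm V) (c : ℝ) : HilbSeminorm V where
  bilin := c ^ 2 • p.bilin
  symm v w := by
    simp only [LinearMap.smul_apply, smul_eq_mul]
    rw [p.symm v w]
  nonneg v := by
    simp only [LinearMap.smul_apply, smul_eq_mul]
    exact mul_nonneg (sq_nonneg c) (p.nonneg v)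

/-- A finite subset `E ⊆ V` is `q`-orthonormal. -/
def IsONS (q : HilbSeminorm V) (E : Finset V) : Prop :=
  (∀ e ∈ E, q.bilin e e = 1) ∧ ∀ e ∈ E, ∀ f ∈ E, e ≠ f → q.bilin e f = 0

open scoped Classical

/-- The trace `tr(p/q)` of a Hilbertian seminorm `p` with respect to a Hilbertian
seminorm `q`: the supremum over finite `q`-orthonormal sets `E` of `∑_{e∈E} p(e)²`
if `ker q ⊆ ker p`, and `∞` otherwise. -/
def trace (p q : HilbSeminorm V) : ℝ≥0∞ :=
  if ∀ v, q.bilin v v = 0 → p.bilin v v = 0 then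
    ⨆ (E : Finset V) (_ : q.IsONS E), ENNReal.ofReal (∑ e ∈ E, p.bilin e e)
  else ⊤

end HilbSeminorm

section AlgebraDefs

variable {A : Type*} [CommRing A] [Algebra ℝ A]

/-- The restriction `α|_V` of a character `α` is `q`-continuous. -/
def QContOn (V : Submodule ℝ A) (q : ↥V → ℝ) (α : Character A) : Prop :=
  ∃ C > 0, ∀ v : V, |α (v : A)| ≤ C * q v

/-- `J`: the family of all subalgebras of `A` generated by finite-dimensional
subspaces of `V`. -/
def finGenSubalgebras (V : Submodule ℝ A) : Set (Subalgebra ℝ A) :=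
  {S | ∃ W : Submodule ℝ A, W ≤ V ∧ FiniteDimensional ℝ ↥W ∧
    S = Algebra.adjoin ℝ (W : Set A)}

/-- The family `{ν_S : S ∈ J}` is `p`-concentrated. -/
def Concentrated (V : Submodule ℝ A) (J : Set (Subalgebra ℝ A)) (p : ↥V → ℝ)
    (ν : ∀ S : Subalgebra ℝ A, Measure (Character ↥S)) : Prop :=
  ∀ ε > (0 : ℝ), ∃ δ > (0 : ℝ), ∀ S ∈ J, ∀ v : V, ∀ hv : (v : A) ∈ S,
    p v ≤ δ → ν S {α : Character ↥S | 1 ≤ |α ⟨(v : A), hv⟩|} ≤ ENNReal.ofReal ε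

/-- A quadratic module in `A`. -/
def IsQuadraticModule (Q : Set A) : Prop :=
  (1 : A) ∈ Q ∧ (∀ x ∈ Q, ∀ y ∈ Q, x + y ∈ Q) ∧ ∀ a : A, ∀ x ∈ Q, a ^ 2 * x ∈ Q

/-- The nonnegativity set `K_Q ⊆ X(A)` of a quadratic module `Q`. -/
def charNonneg (Q : Set A) : Set (Character A) := {α | ∀ a ∈ Q, 0 ≤ α a}

/-- The nonnegativity set `K_{Q ∩ S} ⊆ X(S)` for a subalgebra `S`. -/
def charNonnegOn (Q : Set A) (S : Subalgebra ℝ A) : Set (Character ↥S) :=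
  {α | ∀ a : S, (a : A) ∈ Q → 0 ≤ α a}

/-- The Hilbertian seminorm `s_L(a) = √(L(a²))` induced by a `∑A²`-positive
linear functional `L`, via the bilinear form `(a,b) ↦ L(ab)`. -/
def sLSeminorm (L : A →ₗ[ℝ] ℝ) (hL : ∀ a : A, 0 ≤ L (a * a)) : HilbSeminorm A where
  bilin := (LinearMap.mul ℝ A).compr₂ L
  symm v w := by simp [mul_comm]
  nonneg v := by simpa using hL v

end AlgebraDefs

/-- `τ` is the topology induced by a directed family `P` of Hilbertian
seminorms. -/
def InducedByHilbFamily {V : Type*} [AddCommGroup V] [Module ℝ V]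
    (τ : TopologicalSpace V) (P : Set (HilbSeminorm V)) : Prop :=
  (∀ p ∈ P, ∀ q ∈ P, ∃ r ∈ P, ∀ v, p.toFun v ≤ r.toFun v ∧ q.toFun v ≤ r.toFun v) ∧
  ∀ v : V, (@nhds V τ v).HasBasis
    (fun pe : HilbSeminorm V × ℝ => pe.1 ∈ P ∧ 0 < pe.2)
    (fun pe => {w | pe.1.toFun (w - v) < pe.2})

/-- A topology is nuclear (in the sense of Yamasaki) if it is induced by a
directed family `P` of Hilbertian seminorms such that every `p ∈ P` admits
`q ∈ P` with `tr(p/q) < ∞`. -/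
def IsNuclearTopology {V : Type*} [AddCommGroup V] [Module ℝ V]
    (τ : TopologicalSpace V) : Prop :=
  ∃ P : Set (HilbSeminorm V), InducedByHilbFamily τ P ∧
    ∀ p ∈ P, ∃ q ∈ P, p.trace q < ⊤

end

namespace HilbSeminorm

variable {V : Type*} [AddCommGroup V] [Module ℝ V]

/-- The squared distance to a linear combination of a finite orthonormal family. -/
theorem bilin_sub_sum {ι : Type*} (p : HilbSeminorm V) (f : ι → V) (s : Finset ι)
    (h1 : ∀ i ∈ s, p.bilin (f i) (f i) = 1)
    (h2 : ∀ i ∈ s, ∀ j ∈ s, i ≠ j → p.bilin (f i) (f j) = 0) (c : ι → ℝ) (v : V) :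
    p.bilin (v - ∑ i ∈ s, c i • f i) (v - ∑ i ∈ s, c i • f i) =
      p.bilin v v - ∑ i ∈ s, p.bilin v (f i) ^ 2 + ∑ i ∈ s, (p.bilin v (f i) - c i) ^ 2 := by
  have hcross : p.bilin v (∑ i ∈ s, c i • f i) = ∑ i ∈ s, c i * p.bilin v (f i) := by
    simp [map_sum]
  have hself : p.bilin (∑ i ∈ s, c i • f i) (∑ i ∈ s, c i • f i) = ∑ i ∈ s, c i ^ 2 := by
    simp only [map_sum, LinearMap.sum_apply, map_smul, LinearMap.smul_apply, smul_eq_mul]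
    refine Finset.sum_congr rfl fun i hi => ?_
    rw [Finset.sum_eq_single_of_mem i hi fun j hj hji => by rw [h2 j hj i hi hji]; ring, h1 i hi]
    ring
  rw [map_sub, LinearMap.map_sub₂, LinearMap.map_sub₂, p.symm (∑ i ∈ s, c i • f i) v,
    hcross, hself]
  have : ∑ i ∈ s, (p.bilin v (f i) - c i) ^ 2 =
      ∑ i ∈ s, p.bilin v (f i) ^ 2 - 2 * ∑ i ∈ s, c i * p.bilin v (f i) + ∑ i ∈ s, c i ^ 2 := by
    rw [Finset.mul_sum, ← Finset.sum_sub_distrib, ← Finset.sum_add_distrib]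
    exact Finset.sum_congr rfl fun i _ => by ring
  rw [this]
  ring

/-- Bessel's inequality for a finite orthonormal family. -/
theorem sum_sq_bilin_le {ι : Type*} (p : HilbSeminorm V) (f : ι → V) (s : Finset ι)
    (h1 : ∀ i ∈ s, p.bilin (f i) (f i) = 1)
    (h2 : ∀ i ∈ s, ∀ j ∈ s, i ≠ j → p.bilin (f i) (f j) = 0) (v : V) :
    ∑ i ∈ s, p.bilin v (f i) ^ 2 ≤ p.bilin v v := by
  have h := p.bilin_sub_sum f s h1 h2 (fun i => p.bilin v (f i)) v
  have h0 := p.nonneg (v - ∑ i ∈ s, p.bilin v (f i) • f i)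
  simp only [sub_self, ne_eq, OfNat.ofNat_ne_zero, not_false_eq_true, zero_pow,
    Finset.sum_const_zero] at h
  linarith

/-- Parseval's identity for a complete orthonormal system. -/
theorem hasSum_sq_bilin {ι : Type*} (p : HilbSeminorm V) (e : ι → V)
    (he1 : ∀ n, p.bilin (e n) (e n) = 1)
    (he2 : ∀ m n, m ≠ n → p.bilin (e m) (e n) = 0)
    (hcomplete : ∀ v : V, ∀ ε > (0 : ℝ),
      ∃ w ∈ Submodule.span ℝ (Set.range e), p.toFun (v - w) < ε) (v : V) :
    HasSum (fun n => p.bilin v (e n) ^ 2) (p.bilin v v) := by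
  refine hasSum_of_isLUB_of_nonneg _ (fun n => sq_nonneg _) ⟨?_, fun b hb => ?_⟩
  · rintro _ ⟨s, rfl⟩
    exact p.sum_sq_bilin_le e s (fun i _ => he1 i) (fun i _ j _ => he2 i j) v
  · refine le_of_forall_pos_le_add fun ε hε => ?_
    obtain ⟨w, hw, hlt⟩ := hcomplete v (√ε) (Real.sqrt_pos.2 hε)
    obtain ⟨c, rfl⟩ := Finsupp.mem_span_range_iff_exists_finsupp.1 hw
    have hlt' := (Real.sqrt_lt_sqrt_iff (p.nonneg _)).1 hlt
    rw [Finsupp.sum, p.bilin_sub_sum e c.support (fun i _ => he1 i)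
      (fun i _ j _ => he2 i j)] at hlt'
    have hb' : ∑ i ∈ c.support, p.bilin v (e i) ^ 2 ≤ b := hb ⟨c.support, rfl⟩
    have := Finset.sum_nonneg fun i (_ : i ∈ c.support) => sq_nonneg (p.bilin v (e i) - c i)
    linarith

theorem summable_mul_mul {ι : Type*} {w a b : ι → ℝ} (hw : ∀ i, 0 ≤ w i)
    (ha : Summable fun i => w i * a i ^ 2) (hb : Summable fun i => w i * b i ^ 2) :
    Summable fun i => w i * (a i * b i) := by
  refine .of_norm_bounded (ha.add hb) fun i => ?_
  rw [Real.norm_eq_abs, abs_mul, abs_of_nonneg (hw i), ← mul_add]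
  refine mul_le_mul_of_nonneg_left ?_ (hw i)
  rw [abs_le]
  constructor <;> nlinarith [sq_nonneg (a i + b i), sq_nonneg (a i - b i), sq_nonneg (a i),
    sq_nonneg (b i)]

/-- The vectors whose coefficients along `e` are square summable with weights `w`. -/
def weightedSubmodule {ι : Type*} (p : HilbSeminorm V) (e : ι → V) (w : ι → ℝ)
    (hw : ∀ i, 0 ≤ w i) : Submodule ℝ V where
  carrier := {v | Summable fun i => w i * p.bilin v (e i) ^ 2}
  zero_mem' := by simp
  add_mem' {a b} ha hb := by
    refine ((ha.add hb).add ((summable_mul_mul hw ha hb).mul_left 2)).congr fun i => ?_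
    simp only [map_add, LinearMap.add_apply]
    ring
  smul_mem' c v hv := by
    refine (hv.mul_left (c ^ 2)).congr fun i => ?_
    simp only [map_smul, LinearMap.smul_apply, smul_eq_mul]
    ring

/-- The weighted `ℓ²` seminorm of the coefficients along `e`. -/
noncomputable def weighted {ι : Type*} (p : HilbSeminorm V) (e : ι → V) (w : ι → ℝ)
    (hw : ∀ i, 0 ≤ w i) : HilbSeminorm (p.weightedSubmodule e w hw) where
  bilin := LinearMap.mk₂ ℝ
    (fun u v => ∑' i, w i * (p.bilin (u : V) (e i) * p.bilin (v : V) (e i)))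
    (fun u u' v => by
      rw [← (summable_mul_mul hw u.2 v.2).tsum_add (summable_mul_mul hw u'.2 v.2)]
      refine tsum_congr fun i => ?_
      simp only [Submodule.coe_add, map_add, LinearMap.add_apply]
      ring)
    (fun c u v => by
      rw [smul_eq_mul, ← tsum_mul_left]
      refine tsum_congr fun i => ?_
      simp only [Submodule.coe_smul, map_smul, LinearMap.smul_apply, smul_eq_mul]
      ring)
    (fun u v v' => by
      rw [← (summable_mul_mul hw u.2 v.2).tsum_add (summable_mul_mul hw u.2 v'.2)]
      refine tsum_congr fun i => ?_
      simp only [Submodule.coe_add, map_add, LinearMap.add_apply]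
      ring)
    (fun c u v => by
      rw [smul_eq_mul, ← tsum_mul_left]
      refine tsum_congr fun i => ?_
      simp only [Submodule.coe_smul, map_smul, LinearMap.smul_apply, smul_eq_mul]
      ring)
  symm u v := by
    simp only [LinearMap.mk₂_apply]
    exact tsum_congr fun i => by ring
  nonneg u := by
    simp only [LinearMap.mk₂_apply]
    exact tsum_nonneg fun i => mul_nonneg (hw i) (mul_self_nonneg _)

section Weighted

variable {ι : Type*} (p : HilbSeminorm V) (e : ι → V) (w : ι → ℝ) (hw : ∀ i, 0 ≤ w i)

theorem weighted_bilin_apply (u v : p.weightedSubmodule e w hw) :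
    (p.weighted e w hw).bilin u v =
      ∑' i, w i * (p.bilin (u : V) (e i) * p.bilin (v : V) (e i)) := rfl

theorem weighted_bilin_self (u : p.weightedSubmodule e w hw) :
    (p.weighted e w hw).bilin u u = ∑' i, w i * p.bilin (u : V) (e i) ^ 2 := by
  simp only [weighted_bilin_apply, sq]

variable {p e}

theorem mem_weightedSubmodule (he2 : ∀ m n, m ≠ n → p.bilin (e m) (e n) = 0) (n : ι) :
    e n ∈ p.weightedSubmodule e w hw :=
  (hasSum_single n fun m hm => by simp [he2 n m hm.symm]).summable

theorem weighted_bilin_basis (he2 : ∀ m n, m ≠ n → p.bilin (e m) (e n) = 0)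
    (he1 : ∀ n, p.bilin (e n) (e n) = 1)
    (u : p.weightedSubmodule e w hw) (n : ι) :
    (p.weighted e w hw).bilin u ⟨e n, mem_weightedSubmodule w hw he2 n⟩ =
      w n * p.bilin (u : V) (e n) := by
  rw [weighted_bilin_apply, tsum_eq_single n fun m hm => by simp [he2 n m hm.symm], he1, mul_one]

end Weighted

/-- The trace of `p` relative to the seminorm with weights `(lam n)⁻²` is `∑ (lam n)²`. -/
theorem trace_weighted {ι : Type*} (p : HilbSeminorm V) (e : ι → V)
    (he1 : ∀ n, p.bilin (e n) (e n) = 1)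
    (he2 : ∀ m n, m ≠ n → p.bilin (e m) (e n) = 0)
    (hcomplete : ∀ v : V, ∀ ε > (0 : ℝ),
      ∃ w ∈ Submodule.span ℝ (Set.range e), p.toFun (v - w) < ε)
    (lam : ι → ℝ) (hlam : ∀ n, 0 < lam n) (hsum : Summable fun n => lam n ^ 2)
    (hw : ∀ n, 0 ≤ (lam n)⁻¹ ^ 2) :
    (p.comp (p.weightedSubmodule e (fun n => (lam n)⁻¹ ^ 2) hw).subtype).trace
      (p.weighted e (fun n => (lam n)⁻¹ ^ 2) hw) = ENNReal.ofReal (∑' n, lam n ^ 2) := by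
  classical
  set q := p.weighted e (fun n => (lam n)⁻¹ ^ 2) hw with hq
  let g : ι → p.weightedSubmodule e (fun n => (lam n)⁻¹ ^ 2) hw :=
    fun n => lam n • ⟨e n, mem_weightedSubmodule _ hw he2 n⟩
  have hparseval := p.hasSum_sq_bilin e he1 he2 hcomplete
  have hqg (u) (n : ι) : q.bilin u (g n) = (lam n)⁻¹ * p.bilin (u : V) (e n) := by
    rw [map_smul, hq, weighted_bilin_basis _ hw he2 he1, smul_eq_mul]
    field_simp [(hlam n).ne']
  have hgg (n : ι) : q.bilin (g n) (g n) = 1 := by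
    rw [hqg]
    simp [g, he1, (hlam n).ne']
  have hgh (m n : ι) (h : m ≠ n) : q.bilin (g m) (g n) = 0 := by
    rw [hqg]
    simp [g, he2 m n h]
  rw [trace, if_pos]
  · apply le_antisymm
    · refine iSup₂_le fun E hE => ENNReal.ofReal_le_ofReal ?_
      refine hasSum_le (fun n => ?_) (hasSum_sum fun u (_ : u ∈ E) => hparseval u) hsum.hasSum
      have h := q.sum_sq_bilin_le id E hE.1 hE.2 (g n)
      rw [hgg] at h
      simp only [id, q.symm (g n), hqg, mul_pow, ← Finset.mul_sum] at h
      rwa [inv_pow, inv_mul_le_iff₀ (pow_pos (hlam n) 2), mul_one] at h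
    · rw [ENNReal.ofReal_tsum_of_nonneg (fun n => sq_nonneg _) hsum,
        ENNReal.tsum_eq_iSup_sum]
      refine iSup_le fun s => ?_
      have hinj : Function.Injective g := fun m n h => by
        by_contra hne
        have := hgh m n hne
        rw [h, hgg] at this
        exact one_ne_zero this
      refine le_iSup₂_of_le (s.image g) ⟨?_, ?_⟩ ?_
      · simpa using fun n _ => hgg n
      · simp only [Finset.forall_mem_image]
        exact fun m _ n _ h => hgh m n fun hmn => h (congrArg g hmn)
      · rw [Finset.sum_image hinj.injOn, ENNReal.ofReal_sum_of_nonneg fun n _ => (p.comp _).nonneg _]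
        refine (Finset.sum_congr rfl fun n _ => ?_).le
        simp [comp, g, he1, sq]
  · intro v hv
    refine (hparseval v).unique ?_
    have hz (n : ι) : p.bilin (v : V) (e n) = 0 := by
      have hs := v.2.hasSum
      have hv' : ∑' n, (lam n)⁻¹ ^ 2 * p.bilin (v : V) (e n) ^ 2 = 0 := by
        rw [← hv, hq, weighted_bilin_self]
      rw [hv', hasSum_zero_iff_of_nonneg fun n => mul_nonneg (hw n) (sq_nonneg _)] at hs
      simpa [(hlam n).ne'] using congrFun hs n
    simp [hz]

end HilbSeminorm

/-- Lemma `lemma::a`: construction of a Hilbertian seminorm `q` on a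
dense subspace `U` with `tr(p|_U / q) = ∑ λₙ² < ∞`. -/
theorem statement8 {V : Type*} [AddCommGroup V] [Module ℝ V]
    (p : HilbSeminorm V) (e : ℕ → V)
    (he1 : ∀ n, p.bilin (e n) (e n) = 1)
    (he2 : ∀ m n, m ≠ n → p.bilin (e m) (e n) = 0)
    (hcomplete : ∀ v : V, ∀ ε > (0 : ℝ),
      ∃ w ∈ Submodule.span ℝ (Set.range e), p.toFun (v - w) < ε)
    (lam : ℕ → ℝ) (hlam : ∀ n, 0 < lam n) (hsum : Summable fun n => lam n ^ 2) :
    ∃ U : Submodule ℝ V,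
      (U : Set V) = {v : V | Summable fun n => (lam n)⁻¹ ^ 2 * p.bilin v (e n) ^ 2} ∧
      (∀ v : V, ∀ ε > (0 : ℝ), ∃ u ∈ U, p.toFun (v - u) < ε) ∧
      ∃ q : HilbSeminorm ↥U,
        (∀ u : U, q.toFun u =
          Real.sqrt (∑' n, (lam n)⁻¹ ^ 2 * p.bilin (u : V) (e n) ^ 2)) ∧
        (p.comp U.subtype).trace q = ENNReal.ofReal (∑' n, lam n ^ 2) := by
  have hw : ∀ n, 0 ≤ (lam n)⁻¹ ^ 2 := fun n => sq_nonneg _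
  refine ⟨p.weightedSubmodule e _ hw, rfl, fun v ε hε => ?_, p.weighted e _ hw, fun u => ?_,
    p.trace_weighted e he1 he2 hcomplete lam hlam hsum hw⟩
  · obtain ⟨u, hu, hlt⟩ := hcomplete v ε hε
    refine ⟨u, Submodule.span_le.2 ?_ hu, hlt⟩
    rintro _ ⟨n, rfl⟩
    exact HilbSeminorm.mem_weightedSubmodule _ hw he2 n
  · rw [HilbSeminorm.toFun, HilbSeminorm.weighted_bilin_self]
end

section
/- Let (V, τ_V) be a nuclear space, A a unital commutative ℝ-algebra generated by V, K ⊆ X(A) closed, L a normalized linear functional on A with L(∑A²) ⊆ [0,∞), and Q a quadratic module in A with K = K_Q. Suppose that for each S ∈ J there exists a representing Radon measure ν_S for L|_S with support contained in K_{Q∩S}, and that s_L|_V is τ_V-continuous. Then for every Hilbertian seminorm q on V such that {α ∈ K_Q : α|_V is q-continuous} ≠ ∅ and tr(s_L|_V / q) < ∞, there exists a representing Radon measure for L with support contained in {α ∈ K : α|_V is q-continuous}. -/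
open MeasureTheory
open scoped ENNReal

namespace Character

open Filter Topology

variable {A : Type*} [CommRing A] [Algebra ℝ A]

theorem isInducing_coe : IsInducing (fun (α : Character A) (a : A) => α a) := ⟨rfl⟩

theorem continuous_eval (a : A) : Continuous fun α : Character A => α a :=
  (continuous_apply a).comp isInducing_coe.continuous

theorem tendsto_nhds_iff {ι : Type*} {l : Filter ι} {f : ι → Character A} {β : Character A} :
    Tendsto f l (𝓝 β) ↔ ∀ a, Tendsto (fun i => f i a) l (𝓝 (β a)) := by
  rw [isInducing_coe.tendsto_nhds_iff, tendsto_pi_nhds]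
  rfl

instance : BorelSpace (Character A) := ⟨rfl⟩

instance : T2Space (Character A) :=
  T2Space.of_injective_continuous (f := fun (α : Character A) (a : A) => α a)
    (fun _ _ h => AlgHom.ext fun a => congrFun h a) isInducing_coe.continuous

/-- Asymptotically multiplicative functions which are asymptotically bounded at each element of a
generating set converge pointwise along any ultrafilter to a character. -/
theorem exists_tendsto_of_ultrafilter {s : Set A} (hs : Algebra.adjoin ℝ s = ⊤) {ι : Type*}
    (U : Ultrafilter ι) (g : ι → A → ℝ)
    (hadd : ∀ a b, ∀ᶠ i in (U : Filter ι), g i (a + b) = g i a + g i b)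
    (hmul : ∀ a b, ∀ᶠ i in (U : Filter ι), g i (a * b) = g i a * g i b)
    (halg : ∀ r : ℝ, ∀ᶠ i in (U : Filter ι), g i (algebraMap ℝ A r) = r)
    (hbdd : ∀ a ∈ s, ∃ C, ∀ᶠ i in (U : Filter ι), |g i a| ≤ C) :
    ∃ β : Character A, ∀ a, Tendsto (fun i => g i a) U (𝓝 (β a)) := by
  have key : ∀ a : A, ∃ ℓ, Tendsto (fun i => g i a) U (𝓝 ℓ) := by
    intro a
    have ha : a ∈ Algebra.adjoin ℝ s := hs ▸ Algebra.mem_top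
    induction ha using Algebra.adjoin_induction with
    | mem a ha =>
      obtain ⟨C, hC⟩ := hbdd a ha
      have hK : IsCompact (Set.Icc (-C) C) := isCompact_Icc
      obtain ⟨ℓ, -, hℓ⟩ := hK.ultrafilter_le_nhds (U.map fun i => g i a) (by
        rw [le_principal_iff]
        exact hC.mono fun i hi => abs_le.1 hi)
      exact ⟨ℓ, hℓ⟩
    | algebraMap r => exact ⟨r, tendsto_const_nhds.congr' ((halg r).mono fun _ h => h.symm)⟩
    | add a b _ _ ha hb =>
      obtain ⟨x, hx⟩ := ha
      obtain ⟨y, hy⟩ := hb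
      exact ⟨x + y, (hx.add hy).congr' ((hadd a b).mono fun _ h => h.symm)⟩
    | mul a b _ _ ha hb =>
      obtain ⟨x, hx⟩ := ha
      obtain ⟨y, hy⟩ := hb
      exact ⟨x * y, (hx.mul hy).congr' ((hmul a b).mono fun _ h => h.symm)⟩
  choose β hβ using key
  have hβalg : ∀ r : ℝ, β (algebraMap ℝ A r) = r := fun r =>
    tendsto_nhds_unique (hβ _) (tendsto_const_nhds.congr' ((halg r).mono fun _ h => h.symm))
  refine ⟨{ toFun := β
            map_one' := by simpa using hβalg 1
            map_zero' := by simpa using hβalg 0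
            map_mul' := fun a b => tendsto_nhds_unique (hβ _)
              (((hβ a).mul (hβ b)).congr' ((hmul a b).mono fun _ h => h.symm))
            map_add' := fun a b => tendsto_nhds_unique (hβ _)
              (((hβ a).add (hβ b)).congr' ((hadd a b).mono fun _ h => h.symm))
            commutes' := hβalg }, hβ⟩

theorem isClosed_charNonneg (Q : Set A) : IsClosed (charNonneg Q) := by
  simp only [charNonneg, Set.ofPred_forall]
  exact isClosed_biInter fun a _ => isClosed_le continuous_const (continuous_eval a)

theorem isClosed_charNonnegOn (Q : Set A) (S : Subalgebra ℝ A) :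
    IsClosed (charNonnegOn Q S) := by
  simp only [charNonnegOn, Set.ofPred_forall]
  exact isClosed_iInter fun a => isClosed_iInter fun _ =>
    isClosed_le continuous_const (continuous_eval a)

/-- A closed set of characters that is bounded at each element of a generating set is compact. -/
theorem isCompact_of_bounded {s : Set A} (hs : Algebra.adjoin ℝ s = ⊤) {K : Set (Character A)}
    (hK : IsClosed K) (hbdd : ∀ a ∈ s, ∃ C, ∀ α ∈ K, |α a| ≤ C) : IsCompact K := by
  rw [isCompact_iff_ultrafilter_le_nhds]
  intro U hU
  rw [le_principal_iff] at hU
  obtain ⟨β, hβ⟩ := exists_tendsto_of_ultrafilter hs U (fun α a => α a)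
    (fun a b => .of_forall fun α => map_add α a b) (fun a b => .of_forall fun α => map_mul α a b)
    (fun r => .of_forall fun α => AlgHom.commutes α r)
    (fun a ha => (hbdd a ha).imp fun C hC => mem_of_superset hU hC)
  have hlim : Tendsto id (U : Filter (Character A)) (𝓝 β) := tendsto_nhds_iff.2 hβ
  exact ⟨β, hK.mem_of_tendsto hlim hU, hlim⟩

/-- A linear functional that is nonnegative on the elements nonnegative on a compact set `K` of
characters is represented by a finite inner regular measure supported in `K`. -/
theorem exists_measure_of_isCompact {K : Set (Character A)} (hK : IsCompact K) (Λ : A →ₗ[ℝ] ℝ)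
    (hΛ : ∀ a, (∀ α ∈ K, 0 ≤ α a) → 0 ≤ Λ a) :
    ∃ μ : Measure (Character A), IsFiniteMeasure μ ∧ μ.InnerRegular ∧ μ Kᶜ = 0 ∧
      ∀ a, Integrable (fun α : Character A => α a) μ ∧ ∫ α : Character A, α a ∂μ = Λ a := by
  have : CompactSpace K := isCompact_iff_compactSpace.1 hK
  let T : A →ₗ[ℝ] C(K, ℝ) :=
    { toFun := fun a => ⟨fun α => α.1 a, (continuous_eval a).comp continuous_subtype_val⟩
      map_add' := fun a b => by ext α; simp
      map_smul' := fun r a => by ext α; simp }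
  have hT : ∀ a α, T a α = α.1 a := fun _ _ => rfl
  have hker : LinearMap.ker T ≤ LinearMap.ker Λ := by
    intro a ha
    rw [LinearMap.mem_ker] at ha ⊢
    have h0 : ∀ α ∈ K, α a = 0 := fun α hα => by
      simpa using (hT a ⟨α, hα⟩).symm.trans (by rw [ha]; rfl)
    refine le_antisymm ?_ (hΛ a fun α hα => (h0 α hα).ge)
    have := hΛ (-a) fun α hα => by simp [h0 α hα]
    simpa using this
  let f : C(K, ℝ) →ₗ.[ℝ] ℝ :=
    ⟨LinearMap.range T, ((LinearMap.ker T).liftQ Λ hker).comp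
      T.quotKerEquivRange.symm.toLinearMap⟩
  have hf : ∀ a, f ⟨T a, a, rfl⟩ = Λ a := by
    intro a
    have : T.quotKerEquivRange.symm ⟨T a, a, rfl⟩ = (LinearMap.ker T).mkQ a :=
      LinearMap.quotKerEquivRange_symm_apply_image T a _
    change (LinearMap.ker T).liftQ Λ hker (T.quotKerEquivRange.symm ⟨T a, a, rfl⟩) = _
    rw [this]
    simp
  obtain ⟨g, hgf, hg⟩ := riesz_extension (PointedCone.positive ℝ C(K, ℝ)) f (by
    rintro ⟨_, a, rfl⟩ ha
    rw [hf]
    refine hΛ a fun α hα => ?_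
    exact (ContinuousMap.le_def.1 ha) ⟨α, hα⟩) (by
    intro y
    refine ⟨⟨T (algebraMap ℝ A ‖y‖), _, rfl⟩, ?_⟩
    refine ContinuousMap.le_def.2 fun α => ?_
    have := neg_le_of_abs_le (y.norm_coe_le_norm α)
    simp only [ContinuousMap.zero_apply, ContinuousMap.add_apply, hT, AlgHom.commutes]
    simp only [Algebra.algebraMap_self, RingHom.id_apply]
    linarith)
  let P : CompactlySupportedContinuousMap K ℝ →ₚ[ℝ] ℝ :=
    PositiveLinearMap.mk₀
      { toFun := fun φ => g φ.toContinuousMap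
        map_add' := fun φ ψ => map_add g φ.toContinuousMap ψ.toContinuousMap
        map_smul' := fun r φ => map_smul g r φ.toContinuousMap }
      (fun φ hφ => hg _ (ContinuousMap.le_def.2 fun α => hφ α))
  let m := RealRMK.rieszMeasure P
  have hm : ∀ a, ∫ α : K, α.1 a ∂m = Λ a := by
    intro a
    rw [← hf a, ← hgf]
    exact RealRMK.integral_rieszMeasure P
      (CompactlySupportedContinuousMap.continuousMapEquiv (T a))
  have : m.Regular := by infer_instance
  have : IsFiniteMeasure m := by infer_instance
  have hmeas : Measurable (Subtype.val : K → Character A) := measurable_subtype_coe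
  refine ⟨m.map Subtype.val, inferInstance,
    Measure.InnerRegular.map_of_continuous continuous_subtype_val, ?_, fun a => ⟨?_, ?_⟩⟩
  · rw [Measure.map_apply hmeas hK.isClosed.measurableSet.compl]
    convert measure_empty (μ := m)
    ext α
    simp
  · rw [integrable_map_measure (continuous_eval a).aestronglyMeasurable hmeas.aemeasurable]
    exact ((continuous_eval a).comp continuous_subtype_val).integrable_of_hasCompactSupport
      (HasCompactSupport.of_compactSpace _)
  · rw [integral_map hmeas.aemeasurable (continuous_eval a).aestronglyMeasurable, hm]

end Character

namespace HilbSeminorm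

open LinearMap (BilinForm)

variable {V W : Type*} [AddCommGroup V] [Module ℝ V] [AddCommGroup W] [Module ℝ W]

theorem eq_zero_of_trace_lt_top {p q : HilbSeminorm V} (h : p.trace q < ⊤) {v : V}
    (hv : q.bilin v v = 0) : p.bilin v v = 0 := by
  by_contra hp
  rw [trace, if_neg fun h' => hp (h' v hv)] at h
  exact h.ne rfl

theorem le_trace (p q : HilbSeminorm V) {E : Finset V} (hE : q.IsONS E) :
    ENNReal.ofReal (∑ e ∈ E, p.bilin e e) ≤ p.trace q := by
  rw [trace]
  split_ifs
  · exact le_iSup₂ (f := fun (E : Finset V) (_ : q.IsONS E) =>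
      ENNReal.ofReal (∑ e ∈ E, p.bilin e e)) E hE
  · exact le_top

/-- For an orthogonal family `v`, normalizing the non-null vectors bounds the trace from below. -/
theorem sum_div_le_trace {ι : Type*} [Fintype ι] (p q : HilbSeminorm V) (v : ι → V)
    (hv : ∀ i j, i ≠ j → q.bilin (v i) (v j) = 0) :
    ENNReal.ofReal (∑ i, p.bilin (v i) (v i) / q.bilin (v i) (v i)) ≤ p.trace q := by
  classical
  set b : ι → ℝ := fun i => q.bilin (v i) (v i)
  let J : Finset ι := Finset.univ.filter fun i => b i ≠ 0
  let e : ι → V := fun i => (√(b i))⁻¹ • v i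
  have hbil : ∀ (r : HilbSeminorm V) i j,
      r.bilin (e i) (e j) = (√(b i))⁻¹ * ((√(b j))⁻¹ * r.bilin (v i) (v j)) := by
    intro r i j
    simp [e, mul_left_comm]
  have hdiag : ∀ (r : HilbSeminorm V) i,
      r.bilin (e i) (e i) = r.bilin (v i) (v i) / b i := by
    intro r i
    rw [hbil, ← mul_assoc, ← mul_inv, Real.mul_self_sqrt (q.nonneg (v i)), inv_mul_eq_div]
  have hone : ∀ i ∈ J, q.bilin (e i) (e i) = 1 := fun i hi => by
    rw [hdiag]
    exact div_self (Finset.mem_filter.1 hi).2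
  have hzero : ∀ i j, i ≠ j → q.bilin (e i) (e j) = 0 := fun i j hij => by
    rw [hbil, hv i j hij]
    simp
  have hinj : Set.InjOn e J := by
    intro i hi j hj hij
    by_contra hne
    have h0 := hzero i j hne
    rw [← hij, hone i hi] at h0
    exact one_ne_zero h0
  have hE : q.IsONS (J.image e) := by
    constructor
    · intro x hx
      obtain ⟨i, hi, rfl⟩ := Finset.mem_image.1 hx
      exact hone i hi
    · intro x hx y hy hxy
      obtain ⟨i, hi, rfl⟩ := Finset.mem_image.1 hx
      obtain ⟨j, hj, rfl⟩ := Finset.mem_image.1 hy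
      exact hzero i j fun h => hxy (h ▸ rfl)
  refine le_trans (le_of_eq ?_) (p.le_trace q hE)
  rw [Finset.sum_image hinj]
  congr 1
  simp only [hdiag]
  refine (Finset.sum_subset (Finset.subset_univ J) fun i _ hi => ?_).symm
  have : b i = 0 := by simpa [J] using hi
  change _ / b i = 0
  rw [this, div_zero]

/-- A concentration inequality of Minlos type: a random linear functional on a finite-dimensional
space whose second moments are given by `p` is `q`-bounded by `r` up to probability
`tr(p/q) / r²`. -/
theorem measure_not_bounded_le [FiniteDimensional ℝ W] (p q : HilbSeminorm V) (i : W →ₗ[ℝ] V)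
    (htr : p.trace q < ⊤) {X : Type*} [MeasurableSpace X] (ν : Measure X) (ℓ : X → W →ₗ[ℝ] ℝ)
    (hmeas : ∀ w, Measurable fun x => ℓ x w)
    (hmom : ∀ w, ∫⁻ x, ENNReal.ofReal (ℓ x w ^ 2) ∂ν = ENNReal.ofReal (p.bilin (i w) (i w)))
    {r : ℝ} (hr : 0 < r) :
    ν {x | ¬ ∀ w, |ℓ x w| ≤ r * q.toFun (i w)} ≤ p.trace q / ENNReal.ofReal (r ^ 2) := by
  obtain ⟨v, hv⟩ := LinearMap.BilinForm.exists_orthogonal_basis (B := (q.comp i).bilin)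
    ⟨fun x y => (q.comp i).symm x y⟩
  have hv' : ∀ j k, j ≠ k → q.bilin (i (v j)) (i (v k)) = 0 := fun j k hjk => hv hjk
  set b := fun j => q.bilin (i (v j)) (i (v j)) with hb
  have hb0 : ∀ j, 0 ≤ b j := fun j => q.nonneg _
  let F : X → ℝ := fun x => ∑ j, ℓ x (v j) ^ 2 / b j
  have hF : Measurable F := Finset.measurable_sum _ fun j _ => ((hmeas _).pow_const 2).div_const _
  have hnull : ∀ᵐ x ∂ν, ∀ j, b j = 0 → ℓ x (v j) = 0 := by
    rw [ae_all_iff]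
    intro j
    by_cases hj : b j = 0
    · have h0 := hmom (v j)
      rw [p.eq_zero_of_trace_lt_top htr hj, ENNReal.ofReal_zero,
        lintegral_eq_zero_iff ((hmeas _).pow_const 2).ennreal_ofReal] at h0
      filter_upwards [h0] with x hx _
      have : ℓ x (v j) ^ 2 ≤ 0 := ENNReal.ofReal_eq_zero.1 hx
      exact pow_eq_zero_iff two_ne_zero |>.1 (le_antisymm this (sq_nonneg _))
    · exact .of_forall fun x h => absurd h hj
  have hbound : ∀ x, (∀ j, b j = 0 → ℓ x (v j) = 0) → ∀ w,
      ℓ x w ^ 2 ≤ F x * q.bilin (i w) (i w) := by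
    intro x hx w
    have hq : q.bilin (i w) (i w) = ∑ j, v.repr w j ^ 2 * b j := by
      conv_lhs => rw [← v.sum_repr w]
      simp only [map_sum, map_smul, LinearMap.sum_apply, LinearMap.smul_apply, smul_eq_mul]
      refine Finset.sum_congr rfl fun j _ => ?_
      rw [Finset.sum_eq_single j]
      · simp only [hb]; ring
      · intro k _ hkj
        rw [hv' _ _ hkj]; simp
      · simp
    have hℓ : ℓ x w = ∑ j, (ℓ x (v j) / √(b j)) * (v.repr w j * √(b j)) := by
      conv_lhs => rw [← v.sum_repr w]
      simp only [map_sum, map_smul, smul_eq_mul]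
      refine Finset.sum_congr rfl fun j _ => ?_
      by_cases hj : b j = 0
      · simp [hx j hj]
      · have := (Real.sqrt_pos.2 ((hb0 j).lt_of_ne' hj)).ne'
        field_simp
    rw [hq, hℓ]
    refine (Finset.sum_mul_sq_le_sq_mul_sq _ _ _).trans_eq ?_
    simp only [div_pow, mul_pow, Real.sq_sqrt (hb0 _), F]
  have hsub : ν {x | ¬ ∀ w, |ℓ x w| ≤ r * q.toFun (i w)} ≤
      ν {x | ENNReal.ofReal (r ^ 2) ≤ ENNReal.ofReal (F x)} := by
    refine measure_mono_ae ?_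
    filter_upwards [hnull] with x hx hbad
    by_contra hlt
    refine hbad fun w => ?_
    have hlt' : F x < r ^ 2 := by
      by_contra h
      exact hlt (ENNReal.ofReal_le_ofReal (not_lt.1 h))
    rw [toFun, ← Real.sqrt_sq hr.le, ← Real.sqrt_mul (sq_nonneg r)]
    exact Real.abs_le_sqrt ((hbound x hx w).trans
      (mul_le_mul_of_nonneg_right hlt'.le (q.nonneg _)))
  have hint : ∫⁻ x, ENNReal.ofReal (F x) ∂ν ≤ p.trace q := by
    refine le_trans (le_of_eq ?_) (p.sum_div_le_trace q (fun j => i (v j)) hv')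
    have hnn : ∀ x, ∀ j ∈ Finset.univ, 0 ≤ ℓ x (v j) ^ 2 / b j :=
      fun x j _ => div_nonneg (sq_nonneg _) (hb0 j)
    simp only [F, ENNReal.ofReal_sum_of_nonneg (hnn _)]
    rw [ENNReal.ofReal_sum_of_nonneg fun j _ => div_nonneg (p.nonneg _) (hb0 j),
      lintegral_finsetSum _ fun j _ => (((hmeas _).pow_const 2).div_const _).ennreal_ofReal]
    refine Finset.sum_congr rfl fun j _ => ?_
    simp only [div_eq_mul_inv, ENNReal.ofReal_mul (sq_nonneg _), ENNReal.ofReal_mul (p.nonneg _)]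
    rw [lintegral_mul_const _ ((hmeas _).pow_const 2).ennreal_ofReal, hmom]
  refine hsub.trans ?_
  rw [ENNReal.le_div_iff_mul_le (.inl (ENNReal.ofReal_pos.2 (by positivity)).ne')
    (.inl ENNReal.ofReal_ne_top), mul_comm]
  exact (mul_meas_ge_le_lintegral hF.ennreal_ofReal _).trans hint

end HilbSeminorm

open Filter Topology

section FiniteDimensionalApproximation

variable {A : Type*} [CommRing A] [Algebra ℝ A]

/-- The value at `a : A` of a character of a subalgebra `S`, extended by zero outside `S`. -/
noncomputable def Character.evalOn {S : Subalgebra ℝ A} (α : Character S) (a : A) : ℝ :=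
  open Classical in if h : a ∈ S then α ⟨a, h⟩ else 0

namespace Character

variable {S : Subalgebra ℝ A} {a b : A}

theorem evalOn_of_mem (α : Character S) (ha : a ∈ S) : α.evalOn a = α ⟨a, ha⟩ := dif_pos ha

theorem evalOn_add (α : Character S) (ha : a ∈ S) (hb : b ∈ S) :
    α.evalOn (a + b) = α.evalOn a + α.evalOn b := by
  rw [evalOn_of_mem α ha, evalOn_of_mem α hb, evalOn_of_mem α (add_mem ha hb), ← map_add]
  rfl

theorem evalOn_mul (α : Character S) (ha : a ∈ S) (hb : b ∈ S) :
    α.evalOn (a * b) = α.evalOn a * α.evalOn b := by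
  rw [evalOn_of_mem α ha, evalOn_of_mem α hb, evalOn_of_mem α (mul_mem ha hb), ← map_mul]
  rfl

theorem evalOn_smul (α : Character S) (r : ℝ) (ha : a ∈ S) :
    α.evalOn (r • a) = r * α.evalOn a := by
  rw [evalOn_of_mem α ha, evalOn_of_mem α (S.smul_mem ha r), ← smul_eq_mul, ← map_smul]
  rfl

theorem evalOn_algebraMap (α : Character S) (r : ℝ) : α.evalOn (algebraMap ℝ A r) = r := by
  rw [evalOn_of_mem α (S.algebraMap_mem r)]
  exact α.commutes r

theorem continuous_evalOn (a : A) : Continuous fun α : Character S => α.evalOn a := by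
  by_cases ha : a ∈ S
  · simp only [evalOn_of_mem _ ha]
    exact continuous_eval _
  · simp only [evalOn, dif_neg ha]
    exact continuous_const

end Character

/-- The directed set of finite-dimensional subspaces of `V`. -/
abbrev FiniteSubspace (V : Submodule ℝ A) :=
  {W : Submodule ℝ A // W ≤ V ∧ FiniteDimensional ℝ W}

namespace FiniteSubspace

variable {V : Submodule ℝ A}

instance : Nonempty (FiniteSubspace V) := ⟨⟨⊥, bot_le, inferInstance⟩⟩

instance : IsDirectedOrder (FiniteSubspace V) where
  directed W₁ W₂ := by
    have := W₁.2.2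
    have := W₂.2.2
    exact ⟨⟨W₁.1 ⊔ W₂.1, sup_le W₁.2.1 W₂.2.1, inferInstance⟩,
      le_sup_left (a := W₁.1), le_sup_right (b := W₂.1)⟩

/-- The subalgebra generated by a finite-dimensional subspace. -/
abbrev algebra (W : FiniteSubspace V) : Subalgebra ℝ A := Algebra.adjoin ℝ (W.1 : Set A)

theorem algebra_mem (W : FiniteSubspace V) : W.algebra ∈ finGenSubalgebras V :=
  ⟨W.1, W.2.1, W.2.2, rfl⟩

theorem mem_algebra (W : FiniteSubspace V) {v : A} (hv : v ∈ W.1) : v ∈ W.algebra :=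
  Algebra.subset_adjoin hv

theorem eventually_mem {v : A} (hv : v ∈ V) :
    ∀ᶠ W : FiniteSubspace V in atTop, v ∈ W.1 := by
  let W₀ : FiniteSubspace V := ⟨Submodule.span ℝ {v}, by simpa using hv, inferInstance⟩
  filter_upwards [eventually_ge_atTop W₀] with W hW
  exact hW (Submodule.mem_span_singleton_self v)

theorem eventually_mem_algebra (hgen : Algebra.adjoin ℝ (V : Set A) = ⊤) (a : A) :
    ∀ᶠ W : FiniteSubspace V in atTop, a ∈ W.algebra := by
  have ha : a ∈ Algebra.adjoin ℝ (V : Set A) := hgen ▸ Algebra.mem_top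
  induction ha using Algebra.adjoin_induction with
  | mem a ha => exact (eventually_mem ha).mono fun W hW => W.mem_algebra hW
  | algebraMap r => exact .of_forall fun W => W.algebra.algebraMap_mem r
  | add a b _ _ ha hb => exact ha.mp (hb.mono fun W hb ha => add_mem ha hb)
  | mul a b _ _ ha hb => exact ha.mp (hb.mono fun W hb ha => mul_mem ha hb)

/-- An element that is nonnegative on the characters in `K_Q` bounded by `c` on `V` is almost
nonnegative on the bounded characters of large subalgebras. -/
theorem eventually_neg_lt_evalOn (hgen : Algebra.adjoin ℝ (V : Set A) = ⊤) (Q : Set A)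
    {U : Ultrafilter (FiniteSubspace V)} (hU : (U : Filter (FiniteSubspace V)) ≤ atTop)
    (c : V → ℝ) {a : A}
    (ha : ∀ α ∈ charNonneg Q, (∀ v : V, |α (v : A)| ≤ c v) → 0 ≤ α a) {ε : ℝ} (hε : 0 < ε) :
    ∀ᶠ W : FiniteSubspace V in U, ∀ α : Character W.algebra,
      α ∈ charNonnegOn Q W.algebra → (∀ v : V, (v : A) ∈ W.1 → |α.evalOn (v : A)| ≤ c v) →
        -ε < α.evalOn a := by
  classical
  by_contra h
  rw [← Ultrafilter.eventually_not] at h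
  let P (W : FiniteSubspace V) (α : Character W.algebra) : Prop :=
    α ∈ charNonnegOn Q W.algebra ∧ (∀ v : V, (v : A) ∈ W.1 → |α.evalOn (v : A)| ≤ c v) ∧
      α.evalOn a ≤ -ε
  let g (W : FiniteSubspace V) (b : A) : ℝ := if h : ∃ α, P W α then h.choose.evalOn b else 0
  have hg : ∀ᶠ W in (U : Filter (FiniteSubspace V)), ∃ α, P W α ∧ ∀ b, g W b = α.evalOn b := by
    filter_upwards [h] with W hW
    push Not at hW
    have hex : ∃ α, P W α := hW
    exact ⟨hex.choose, hex.choose_spec, fun b => dif_pos hex⟩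
  have hmem := fun b => hU (eventually_mem_algebra hgen b)
  obtain ⟨β, hβ⟩ := Character.exists_tendsto_of_ultrafilter hgen U g
    (fun b b' => by
      filter_upwards [hg, hmem b, hmem b'] with W ⟨α, _, hα⟩ hb hb'
      simp only [hα, α.evalOn_add hb hb'])
    (fun b b' => by
      filter_upwards [hg, hmem b, hmem b'] with W ⟨α, _, hα⟩ hb hb'
      simp only [hα, α.evalOn_mul hb hb'])
    (fun r => by
      filter_upwards [hg] with W ⟨α, _, hα⟩
      simp only [hα, α.evalOn_algebraMap])
    (fun v hv => ⟨c ⟨v, hv⟩, by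
      filter_upwards [hg, hU (eventually_mem hv)] with W ⟨α, hP, hα⟩ hW
      rw [hα]
      exact hP.2.1 ⟨v, hv⟩ hW⟩)
  have hβa : β a ≤ -ε := le_of_tendsto (hβ a) <| by
    filter_upwards [hg] with W ⟨α, hP, hα⟩
    rw [hα]
    exact hP.2.2
  have := ha β
    (fun x hx => ge_of_tendsto (hβ x) <| by
      filter_upwards [hg, hmem x] with W ⟨α, hP, hα⟩ hxW
      rw [hα, α.evalOn_of_mem hxW]
      exact hP.1 ⟨x, hxW⟩ hx)
    (fun v => le_of_tendsto (hβ v).abs <| by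
      filter_upwards [hg, hU (eventually_mem v.2)] with W ⟨α, hP, hα⟩ hW
      rw [hα]
      exact hP.2.1 v hW)
  linarith

end FiniteSubspace

end FiniteDimensionalApproximation

section Representation

variable {A : Type*} [CommRing A] [Algebra ℝ A]

/-- A normalized functional that is represented by a measure forces integrability, since a
nonintegrable `a` would give `L (1 + a) = 0 = L a`. -/
theorem integrable_of_represents {L : A →ₗ[ℝ] ℝ} (hL1 : L 1 = 1) {ν : Measure (Character A)}
    (hν : ∀ a : A, L a = ∫ α : Character A, α a ∂ν) (a : A) :
    Integrable (fun α : Character A => α a) ν := by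
  have h1 : Integrable (fun _ : Character A => (1 : ℝ)) ν := by
    by_contra h
    have := hν 1
    simp only [map_one, hL1] at this
    rw [integral_undef h] at this
    exact one_ne_zero this
  by_contra h
  have h' : ¬ Integrable (fun α : Character A => α (1 + a)) ν := fun h' => h <| by
    simpa [Pi.sub_def] using h'.sub h1
  have e := hν (1 + a)
  rw [integral_undef h', map_add, hL1, hν a, integral_undef h] at e
  norm_num at e

theorem isProbabilityMeasure_of_represents {L : A →ₗ[ℝ] ℝ} (hL1 : L 1 = 1)
    {ν : Measure (Character A)} (hν : ∀ a : A, L a = ∫ α : Character A, α a ∂ν) :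
    IsProbabilityMeasure ν := by
  have h := hν 1
  simp only [map_one, hL1, integral_const, smul_eq_mul, mul_one] at h
  refine ⟨?_⟩
  rw [← ENNReal.toReal_eq_one_iff]
  exact h.symm

theorem abs_setIntegral_le {X : Type*} [MeasurableSpace X] {ν : Measure X} [IsFiniteMeasure ν]
    {f : X → ℝ} (hf : Integrable f ν) (hf2 : Integrable (fun x => f x ^ 2) ν) (s : Set X)
    {r : ℝ} (hr : 0 < r) :
    |∫ x in s, f x ∂ν| ≤ ((∫ x, f x ^ 2 ∂ν) / r + r * ν.real s) / 2 := by
  have hpt : ∀ x, |f x| ≤ (f x ^ 2 / r + r) / 2 := by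
    intro x
    have h : 0 ≤ (|f x| - r) ^ 2 / r := by positivity
    have e : (|f x| - r) ^ 2 / r = f x ^ 2 / r + r - 2 * |f x| := by
      rw [← sq_abs (f x)]
      field_simp
      ring
    linarith
  calc |∫ x in s, f x ∂ν| ≤ ∫ x in s, |f x| ∂ν := abs_integral_le_integral_abs
    _ ≤ ∫ x in s, (f x ^ 2 / r + r) / 2 ∂ν :=
      integral_mono hf.abs.integrableOn
        (((hf2.div_const r).integrableOn.add (integrable_const r)).div_const 2) hpt
    _ = ((∫ x in s, f x ^ 2 ∂ν) / r + r * ν.real s) / 2 := by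
      rw [integral_div, integral_add (hf2.div_const r).integrableOn (integrable_const r),
        integral_div]
      simp [mul_comm]
    _ ≤ _ := by
      gcongr ((?_ / r + _) / 2)
      exact setIntegral_le_integral hf2 (.of_forall fun x => sq_nonneg _)

/-- Linear functionals increasing to `L` along compact sets of characters glue to a representing
measure of `L`. -/
theorem exists_measure_of_tendsto {L : A →ₗ[ℝ] ℝ} {Γ : ℕ → A →ₗ[ℝ] ℝ} {K : ℕ → Set (Character A)}
    (hΓ0 : Γ 0 = 0) (hK : ∀ n, IsCompact (K n))
    (hΓK : ∀ n a, (∀ α ∈ K n, 0 ≤ α a) → Γ n a ≤ Γ (n + 1) a)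
    (hlim : ∀ a, Tendsto (fun n => Γ n a) atTop (𝓝 (L a))) :
    ∃ μ : Measure (Character A), IsFiniteMeasure μ ∧ μ.InnerRegular ∧
      (∀ a : A, L a = ∫ α : Character A, α a ∂μ) ∧ ∀ G, (∀ n, K n ⊆ G) → μ Gᶜ = 0 := by
  choose m hfin hreg hsupp hint using fun n =>
    Character.exists_measure_of_isCompact (hK n) (Γ (n + 1) - Γ n)
      (fun a ha => sub_nonneg.2 (hΓK n a ha))
  have hsum : ∀ a N, ∑ n ∈ Finset.range N, (Γ (n + 1) - Γ n) a = Γ N a := by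
    intro a N
    simp only [LinearMap.sub_apply]
    rw [Finset.sum_range_sub (fun n => Γ n a), hΓ0]
    simp
  have hlint : ∀ a : A, ∫⁻ α : Character A, ENNReal.ofReal (1 + α a ^ 2) ∂Measure.sum m ≤
      ENNReal.ofReal (L (1 + a ^ 2)) := by
    intro a
    have hpos : ∀ α : Character A, 0 ≤ α (1 + a ^ 2) := fun α => by
      simp only [map_add, map_one, map_pow]
      positivity
    have hmono : Monotone fun n => Γ n (1 + a ^ 2) :=
      monotone_nat_of_le_succ fun n => hΓK n _ fun α _ => hpos α
    rw [lintegral_sum_measure, ENNReal.tsum_eq_iSup_nat]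
    refine iSup_le fun N => ?_
    have hn : ∀ n, ∫⁻ α : Character A, ENNReal.ofReal (1 + α a ^ 2) ∂m n =
        ENNReal.ofReal ((Γ (n + 1) - Γ n) (1 + a ^ 2)) := by
      intro n
      rw [← (hint n _).2, ofReal_integral_eq_lintegral_ofReal (hint n _).1 (.of_forall hpos)]
      simp
    simp only [hn]
    have hnonneg : ∀ n ∈ Finset.range N, 0 ≤ (Γ (n + 1) - Γ n) (1 + a ^ 2) :=
      fun n _ => sub_nonneg.2 (hmono n.le_succ)
    rw [← ENNReal.ofReal_sum_of_nonneg hnonneg, hsum]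
    exact ENNReal.ofReal_le_ofReal (hmono.ge_of_tendsto (hlim _) N)
  have hfinite : IsFiniteMeasure (Measure.sum m) := ⟨by
    have := hlint 0
    simp only [map_zero] at this
    simp only [ne_eq, OfNat.ofNat_ne_zero, not_false_eq_true, zero_pow, add_zero,
      ENNReal.ofReal_one, lintegral_const, one_mul] at this
    exact this.trans_lt ENNReal.ofReal_lt_top⟩
  have hintegrable : ∀ a : A, Integrable (fun α : Character A => α a) (Measure.sum m) := by
    intro a
    refine ⟨(Character.continuous_eval a).aestronglyMeasurable, ?_⟩
    refine (lintegral_mono fun α => ?_).trans_lt ((hlint a).trans_lt ENNReal.ofReal_lt_top)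
    rw [← ofReal_norm]
    refine ENNReal.ofReal_le_ofReal ?_
    rw [Real.norm_eq_abs, ← sq_abs (α a)]
    nlinarith [sq_nonneg (|α a| - 1)]
  refine ⟨Measure.sum m, hfinite, inferInstance, fun a => ?_, fun G hG => ?_⟩
  · have h := (hasSum_integral_measure (hintegrable a)).tendsto_sum_nat
    simp only [(hint _ a).2, hsum] at h
    exact tendsto_nhds_unique (hlim a) h
  · rw [Measure.sum_apply_eq_zero]
    exact fun n => measure_mono_null (Set.compl_subset_compl.2 (hG n)) (hsupp n)

end Representation

section BoundedCharacters

variable {A : Type*} [CommRing A] [Algebra ℝ A] {V : Submodule ℝ A}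

/-- The characters of `⟨W⟩` that are bounded by `n • q` on `W`; empty for `n = 0`. -/
def FiniteSubspace.boundedCharacters (W : FiniteSubspace V) (q : HilbSeminorm V) (n : ℕ) :
    Set (Character W.algebra) :=
  {α | 0 < n ∧ ∀ v : V, (v : A) ∈ W.1 → |α.evalOn (v : A)| ≤ n * q.toFun v}

namespace FiniteSubspace

variable (W : FiniteSubspace V) (q : HilbSeminorm V)

theorem boundedCharacters_zero : W.boundedCharacters q 0 = ∅ := by
  ext α
  simp [boundedCharacters]

theorem isClosed_boundedCharacters (n : ℕ) : IsClosed (W.boundedCharacters q n) := by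
  obtain rfl | hn := n.eq_zero_or_pos
  · rw [boundedCharacters_zero]
    exact isClosed_empty
  · simp only [boundedCharacters, hn, true_and, Set.ofPred_forall]
    exact isClosed_iInter fun v => isClosed_iInter fun _ =>
      isClosed_le (Character.continuous_evalOn _).abs continuous_const

theorem boundedCharacters_mono (n : ℕ) :
    W.boundedCharacters q n ⊆ W.boundedCharacters q (n + 1) := by
  rintro α ⟨-, h⟩
  refine ⟨n.succ_pos, fun v hv => (h v hv).trans ?_⟩
  refine mul_le_mul_of_nonneg_right ?_ (Real.sqrt_nonneg _)
  exact_mod_cast n.le_succ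

variable {W q} {L : A →ₗ[ℝ] ℝ} {ν : Measure (Character W.algebra)}

theorem isProbabilityMeasure (hL1 : L 1 = 1)
    (hν : ∀ a : W.algebra, L (a : A) = ∫ α : Character W.algebra, α a ∂ν) :
    IsProbabilityMeasure ν :=
  isProbabilityMeasure_of_represents (L := L ∘ₗ W.algebra.val.toLinearMap) hL1 hν

theorem integrable_evalOn (hL1 : L 1 = 1)
    (hν : ∀ a : W.algebra, L (a : A) = ∫ α : Character W.algebra, α a ∂ν) (a : A) :
    Integrable (fun α : Character W.algebra => α.evalOn a) ν := by
  by_cases ha : a ∈ W.algebra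
  · simp only [Character.evalOn_of_mem _ ha]
    exact integrable_of_represents (L := L ∘ₗ W.algebra.val.toLinearMap) hL1 hν _
  · simp only [Character.evalOn, dif_neg ha]
    exact integrable_zero _ _ _

theorem integral_evalOn (hν : ∀ a : W.algebra, L (a : A) = ∫ α : Character W.algebra, α a ∂ν)
    {a : A} (ha : a ∈ W.algebra) :
    ∫ α : Character W.algebra, α.evalOn a ∂ν = L a := by
  simp only [Character.evalOn_of_mem _ ha]
  exact (hν ⟨a, ha⟩).symm

theorem measure_compl_boundedCharacters_le (hL1 : L 1 = 1) (hLsq : ∀ a : A, 0 ≤ L (a * a))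
    (hν : ∀ a : W.algebra, L (a : A) = ∫ α : Character W.algebra, α a ∂ν)
    (htr : ((sLSeminorm L hLsq).comp V.subtype).trace q < ⊤) {n : ℕ} (hn : 0 < n) :
    ν.real (W.boundedCharacters q n)ᶜ ≤
      (((sLSeminorm L hLsq).comp V.subtype).trace q).toReal / n ^ 2 := by
  have := W.2.2
  let ℓ : Character W.algebra → W.1 →ₗ[ℝ] ℝ := fun α =>
    { toFun := fun w => α ⟨w, W.mem_algebra w.2⟩
      map_add' := fun w w' => map_add α ⟨(w : A), W.mem_algebra w.2⟩ ⟨w', W.mem_algebra w'.2⟩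
      map_smul' := fun r w => map_smul α r ⟨(w : A), W.mem_algebra w.2⟩ }
  have hℓ : ∀ α (w : W.1), ℓ α w = α.evalOn (w : A) :=
    fun α w => (α.evalOn_of_mem (W.mem_algebra w.2)).symm
  have key := HilbSeminorm.measure_not_bounded_le ((sLSeminorm L hLsq).comp V.subtype) q
    (Submodule.inclusion W.2.1) htr ν ℓ (fun w => (Character.continuous_eval _).measurable)
    (fun w => by
      have hw := W.mem_algebra w.2
      have hsq : ∀ α, ℓ α w ^ 2 = α.evalOn ((w : A) * w) := fun α => by
        rw [hℓ, α.evalOn_mul hw hw, sq]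
      rw [← ofReal_integral_eq_lintegral_ofReal ?_ (.of_forall fun α => sq_nonneg _)]
      · simp only [hsq]
        rw [integral_evalOn hν (mul_mem hw hw)]
        rfl
      · simp only [hsq]
        exact integrable_evalOn hL1 hν _)
    (r := n) (by exact_mod_cast hn)
  have hset : (W.boundedCharacters q n)ᶜ =
      {α | ¬ ∀ w, |ℓ α w| ≤ n * q.toFun (Submodule.inclusion W.2.1 w)} := by
    ext α
    simp only [boundedCharacters, hn, true_and, Set.mem_compl_iff, Set.mem_ofPred_eq, hℓ]
    refine not_congr ⟨fun h w => h (Submodule.inclusion W.2.1 w) w.2, fun h v hv => h ⟨v, hv⟩⟩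
  rw [← hset] at key
  have hn0 : (0 : ℝ) < (n : ℝ) ^ 2 := by positivity
  refine (ENNReal.toReal_mono ?_ key).trans_eq ?_
  · exact ENNReal.div_ne_top htr.ne (ENNReal.ofReal_pos.2 hn0).ne'
  · rw [ENNReal.toReal_div, ENNReal.toReal_ofReal hn0.le]

/-- The truncation error of the moments of a representing measure is uniform in `W`. -/
theorem abs_sub_setIntegral_le (hL1 : L 1 = 1) (hLsq : ∀ a : A, 0 ≤ L (a * a))
    (hν : ∀ a : W.algebra, L (a : A) = ∫ α : Character W.algebra, α a ∂ν)
    (htr : ((sLSeminorm L hLsq).comp V.subtype).trace q < ⊤) {n : ℕ} (hn : 0 < n)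
    {a : A} (ha : a ∈ W.algebra) :
    |L a - ∫ α in W.boundedCharacters q n, α.evalOn a ∂ν| ≤
      (L (a * a) + (((sLSeminorm L hLsq).comp V.subtype).trace q).toReal) / 2 / n := by
  have := isProbabilityMeasure hL1 hν
  have hn0 : (0 : ℝ) < n := by exact_mod_cast hn
  have hsq : ∀ α : Character W.algebra, α.evalOn a ^ 2 = α.evalOn (a * a) := fun α => by
    rw [α.evalOn_mul ha ha, sq]
  have hint := integrable_evalOn hL1 hν a
  rw [← integral_evalOn hν ha,
    ← setIntegral_compl (W.isClosed_boundedCharacters q n).measurableSet hint]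
  refine (abs_setIntegral_le hint (by simpa only [hsq] using integrable_evalOn hL1 hν (a * a)) _
    hn0).trans ?_
  simp only [hsq]
  rw [integral_evalOn hν (mul_mem ha ha)]
  have hT := mul_le_mul_of_nonneg_left
    (measure_compl_boundedCharacters_le hL1 hLsq hν htr hn) hn0.le
  have e : (n : ℝ) * ((((sLSeminorm L hLsq).comp V.subtype).trace q).toReal / n ^ 2) =
      (((sLSeminorm L hLsq).comp V.subtype).trace q).toReal / n := by
    field_simp
  rw [e] at hT
  rw [div_right_comm, add_div _ _ (n : ℝ)]
  linarith

end FiniteSubspace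

end BoundedCharacters

section Truncation

variable {A : Type*} [CommRing A] [Algebra ℝ A] {V : Submodule ℝ A}

/-- The functionals obtained by integrating over the bounded characters of `⟨W⟩` converge along an
ultrafilter to functionals increasing to `L` along the bounded characters of `A` in `K_Q`. -/
theorem exists_truncated_functionals (hgen : Algebra.adjoin ℝ (V : Set A) = ⊤)
    {L : A →ₗ[ℝ] ℝ} (hL1 : L 1 = 1) (hLsq : ∀ a : A, 0 ≤ L (a * a)) (Q : Set A)
    (ν : ∀ W : FiniteSubspace V, Measure (Character W.algebra))
    (hν : ∀ W (a : W.algebra), L (a : A) = ∫ α : Character W.algebra, α a ∂ν W)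
    (hνQ : ∀ W : FiniteSubspace V, ∀ᵐ α ∂ν W, α ∈ charNonnegOn Q W.algebra) (q : HilbSeminorm V)
    (htr : ((sLSeminorm L hLsq).comp V.subtype).trace q < ⊤) :
    ∃ Γ : ℕ → A →ₗ[ℝ] ℝ, Γ 0 = 0 ∧
      (∀ n a, (∀ α ∈ charNonneg Q, (∀ v : V, |α (v : A)| ≤ (n + 1 : ℕ) * q.toFun v) → 0 ≤ α a) →
        Γ n a ≤ Γ (n + 1) a) ∧
      ∀ a, Tendsto (fun n => Γ n a) atTop (𝓝 (L a)) := by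
  let U : Ultrafilter (FiniteSubspace V) := Ultrafilter.of atTop
  have hU : (U : Filter (FiniteSubspace V)) ≤ atTop := Ultrafilter.of_le atTop
  have hmem : ∀ b, ∀ᶠ W : FiniteSubspace V in U, b ∈ W.algebra := fun b =>
    hU (FiniteSubspace.eventually_mem_algebra hgen b)
  have hprob := fun W => FiniteSubspace.isProbabilityMeasure hL1 (hν W)
  have hint := fun W => FiniteSubspace.integrable_evalOn hL1 (hν W)
  let F (n : ℕ) (W : FiniteSubspace V) (a : A) : ℝ :=
    ∫ α in W.boundedCharacters q n, α.evalOn a ∂ν W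
  have htail : ∀ n : ℕ, 0 < n → ∀ a, ∀ᶠ W in (U : Filter (FiniteSubspace V)), |L a - F n W a| ≤
      (L (a * a) + (((sLSeminorm L hLsq).comp V.subtype).trace q).toReal) / 2 / n :=
    fun n hn a => (hmem a).mono fun W ha =>
      FiniteSubspace.abs_sub_setIntegral_le hL1 hLsq (hν W) htr hn ha
  have hF0 : ∀ W a, F 0 W a = 0 := fun W a => by
    simp [F, FiniteSubspace.boundedCharacters_zero]
  have hlim : ∀ n a, ∃ ℓ, Tendsto (fun W => F n W a) U (𝓝 ℓ) := by
    intro n a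
    obtain rfl | hn := n.eq_zero_or_pos
    · exact ⟨0, by simp only [hF0]; exact tendsto_const_nhds⟩
    · set C := (L (a * a) + (((sLSeminorm L hLsq).comp V.subtype).trace q).toReal) / 2 / n
      obtain ⟨ℓ, -, hℓ⟩ := (isCompact_Icc (a := L a - C) (b := L a + C)).ultrafilter_le_nhds
        (U.map fun W => F n W a) (by
          rw [le_principal_iff]
          refine (htail n hn a).mono fun W hW => ?_
          have := abs_le.1 hW
          exact ⟨by linarith, by linarith⟩)
      exact ⟨ℓ, hℓ⟩
  choose γ hγ using hlim
  let Γ : ℕ → A →ₗ[ℝ] ℝ := fun n =>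
    { toFun := γ n
      map_add' := fun a b => tendsto_nhds_unique (hγ n _) <| ((hγ n a).add (hγ n b)).congr' <| by
        filter_upwards [hmem a, hmem b] with W ha hb
        simp only [F]
        rw [← integral_add (hint W a).integrableOn (hint W b).integrableOn]
        simp only [Character.evalOn_add _ ha hb]
      map_smul' := fun r a => tendsto_nhds_unique (hγ n _) <| ((hγ n a).const_mul r).congr' <| by
        filter_upwards [hmem a] with W ha
        simp only [F]
        rw [← integral_const_mul]
        simp only [Character.evalOn_smul _ r ha] }
  have hΓ : ∀ n a, Tendsto (fun W => F n W a) U (𝓝 (Γ n a)) := hγ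
  refine ⟨Γ, ?_, ?_, ?_⟩
  · ext a
    refine tendsto_nhds_unique (hΓ 0 a) ?_
    simp only [hF0]
    exact tendsto_const_nhds
  · intro n a ha
    refine le_of_forall_pos_le_add fun ε hε => ?_
    refine le_of_tendsto_of_tendsto (hΓ n a) ((hΓ (n + 1) a).add_const ε) ?_
    filter_upwards [FiniteSubspace.eventually_neg_lt_evalOn hgen Q hU
      (fun v => (n + 1 : ℕ) * q.toFun v) ha hε] with W hW
    have hB := fun k => (W.isClosed_boundedCharacters q k).measurableSet
    have hdiff : F (n + 1) W a - F n W a =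
        ∫ α in W.boundedCharacters q (n + 1) \ W.boundedCharacters q n, α.evalOn a ∂ν W :=
      (setIntegral_sdiff (hB n) (hint W a).integrableOn (W.boundedCharacters_mono q n)).symm
    have hge : ∫ _α in W.boundedCharacters q (n + 1) \ W.boundedCharacters q n, -ε ∂ν W ≤
        ∫ α in W.boundedCharacters q (n + 1) \ W.boundedCharacters q n, α.evalOn a ∂ν W := by
      refine setIntegral_mono_on_ae (integrable_const _).integrableOn (hint W a).integrableOn
        ((hB _).diff (hB n)) ?_
      filter_upwards [hνQ W] with α hα hαB
      exact (hW α hα hαB.1.2).le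
    rw [setIntegral_const, smul_eq_mul] at hge
    have h1 : (ν W).real (W.boundedCharacters q (n + 1) \ W.boundedCharacters q n) ≤ 1 :=
      measureReal_le_one
    nlinarith
  · intro a
    rw [tendsto_iff_dist_tendsto_zero]
    refine squeeze_zero' (.of_forall fun n => dist_nonneg) ?_ (tendsto_const_div_atTop_nhds_zero_nat
      ((L (a * a) + (((sLSeminorm L hLsq).comp V.subtype).trace q).toReal) / 2))
    filter_upwards [eventually_gt_atTop 0] with n hn
    rw [dist_comm, Real.dist_eq]
    exact le_of_tendsto ((hΓ n a).const_sub (L a)).abs (htail n hn a)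

end Truncation

/-- Corollary `thm-nucelar-criterium::cor`: existence of representing
measures when the generating subspace carries a nuclear topology. -/
theorem statement9 {A : Type*} [CommRing A] [Algebra ℝ A]
    (V : Submodule ℝ A) (hgen : Algebra.adjoin ℝ (V : Set A) = ⊤)
    (τ : TopologicalSpace ↥V) (hnuc : IsNuclearTopology τ)
    (L : A →ₗ[ℝ] ℝ) (hL1 : L 1 = 1) (hLsq : ∀ a : A, 0 ≤ L (a * a))
    (Q : Set A) (hQ : IsQuadraticModule Q)
    (ν : ∀ S : Subalgebra ℝ A, Measure (Character ↥S))
    (hν : ∀ S ∈ finGenSubalgebras V, IsRadonMeasure (ν S) ∧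
      (∀ a : S, L (a : A) = ∫ α : Character ↥S, α a ∂(ν S)) ∧
      ν S {α : Character ↥S | α ∉ charNonnegOn Q S} = 0)
    (hsL : @Continuous ↥V ℝ τ _ ((sLSeminorm L hLsq).comp V.subtype).toFun) :
    ∀ q : HilbSeminorm ↥V,
      (∃ α : Character A, α ∈ charNonneg Q ∧ QContOn V q.toFun α) →
      ((sLSeminorm L hLsq).comp V.subtype).trace q < ⊤ →
      ∃ ν' : Measure (Character A), IsRadonMeasure ν' ∧
        (∀ a : A, L a = ∫ α : Character A, α a ∂ν') ∧
        ν' {α : Character A | ¬ (α ∈ charNonneg Q ∧ QContOn V q.toFun α)} = 0 := by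
  intro q _ htr
  obtain ⟨Γ, hΓ0, hΓpos, hΓlim⟩ := exists_truncated_functionals hgen hL1 hLsq Q
    (fun W : FiniteSubspace V => ν W.algebra) (fun W => (hν _ W.algebra_mem).2.1)
    (fun W => (hν _ W.algebra_mem).2.2) q htr
  let K : ℕ → Set (Character A) := fun n =>
    {α | α ∈ charNonneg Q ∧ ∀ v : V, |α (v : A)| ≤ (n + 1 : ℕ) * q.toFun v}
  have hKclosed : ∀ n, IsClosed (K n) := fun n => by
    refine (Character.isClosed_charNonneg Q).inter (s₂ := {α | ∀ v : V, |α (v : A)| ≤ (n + 1 : ℕ) *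
      q.toFun v}) ?_
    rw [Set.ofPred_forall]
    exact isClosed_iInter fun v =>
      isClosed_le (Character.continuous_eval _).abs continuous_const
  obtain ⟨μ, hfin, hreg, hrep, hsupp⟩ := exists_measure_of_tendsto (K := K) hΓ0
    (fun n => Character.isCompact_of_bounded hgen (hKclosed n)
      fun a ha => ⟨(n + 1 : ℕ) * q.toFun ⟨a, ha⟩, fun α hα => hα.2 ⟨a, ha⟩⟩)
    (fun n a ha => hΓpos n a fun α hα hαv => ha α ⟨hα, hαv⟩) hΓlim
  refine ⟨μ, ⟨inferInstance, hreg.innerRegular⟩, hrep,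
    hsupp {α | α ∈ charNonneg Q ∧ QContOn V q.toFun α} fun n α hα =>
      ⟨hα.1, (n + 1 : ℕ), by positivity, hα.2⟩⟩
end
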